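/- For every quaternion η ∈ ℍ and every φ ∈ ℝ, setting X := e^{iφ}·η and V := i·e^{iφ}·η, one has I(V)·X + I(X)·V = 0; that is, the differential of the Hopf map annihilates the vector field tangent to the Hopf circle fibers. -/

import Mathlib

noncomputable section

/-- The quaternion i. -/
def qi : Quaternion ℝ := ⟨0, 1, 0, 0⟩

/-- The ℝ-linear involution of ℍ fixing 1, j, k and sending i to −i. -/
def Iinv (q : Quaternion ℝ) : Quaternion ℝ := ⟨q.re, -q.imI, q.imJ, q.imK⟩

/-- The quaternion e^{iφ} = cos φ + (sin φ)·i. -/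
def expI (φ : ℝ) : Quaternion ℝ := ⟨Real.cos φ, Real.sin φ, 0, 0⟩

@[simp] lemma qi_re : qi.re = 0 := rfl
@[simp] lemma qi_imI : qi.imI = 1 := rfl
@[simp] lemma qi_imJ : qi.imJ = 0 := rfl
@[simp] lemma qi_imK : qi.imK = 0 := rfl

@[simp] lemma Iinv_re (q : Quaternion ℝ) : (Iinv q).re = q.re := rfl
@[simp] lemma Iinv_imI (q : Quaternion ℝ) : (Iinv q).imI = -q.imI := rfl
@[simp] lemma Iinv_imJ (q : Quaternion ℝ) : (Iinv q).imJ = q.imJ := rfl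
@[simp] lemma Iinv_imK (q : Quaternion ℝ) : (Iinv q).imK = q.imK := rfl

/-- The involution reverses products. -/
lemma Iinv_mul (p q : Quaternion ℝ) : Iinv (p * q) = Iinv q * Iinv p := by
  ext <;> simp only [Iinv_re, Iinv_imI, Iinv_imJ, Iinv_imK, Quaternion.re_mul,
    Quaternion.imI_mul, Quaternion.imJ_mul, Quaternion.imK_mul] <;> ring

lemma Iinv_qi : Iinv qi = -qi := by
  ext <;> simp

/-- The differential of the Hopf map annihilates the vector field
V = i·e^{iφ}·η tangent to the Hopf circle fibers at X = e^{iφ}·η. -/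
theorem hopf_differential_kills_fiber_direction (η : Quaternion ℝ) (φ : ℝ) :
    Iinv (qi * expI φ * η) * (expI φ * η)
      + Iinv (expI φ * η) * (qi * expI φ * η) = 0 := by
  rw [mul_assoc, Iinv_mul qi, Iinv_qi, mul_neg, neg_mul, mul_assoc, neg_add_cancel]
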